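/- arXiv:math/0508150 — 3 statements merged into one kernel-verified Lean document; each statement's English description precedes it below -/
import Mathlib

section
/- Let N > r ≥ 1 be natural numbers and define f : (−1,1)^N → ℝ by f(x₁,…,x_N) = ∏_{1≤j<k≤N}(x_k − x_j)² · ∏_{1≤j≤N}(1 − x_j)^{−1/2}(1 + x_j)^{−1/2}. For t = (t₁,…,t_r) ∈ (0,1)^r let K(t) = ∏_{k=1}^r [1 − t_k, 1). Then for every Borel set J ⊆ (−1,1)^{N−r}, as t → 0 (i.e., each t_k → 0 from the right), the conditional probability F(t) = (∫_{J × K(t)} f dx) / (∫_{(−1,1)^{N−r} × K(t)} f dx) converges to (∫_J ∏_{1≤j<k≤N−r}(x_k − x_j)² · ∏_{1≤j≤N−r}(1 − x_j)^{2r − 1/2}(1 + x_j)^{−1/2} dx) / (∫_{(−1,1)^{N−r}} ∏_{1≤j<k≤N−r}(x_k − x_j)² · ∏_{1≤j≤N−r}(1 − x_j)^{2r − 1/2}(1 + x_j)^{−1/2} dx). -/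
open MeasureTheory Real Finset Filter

/-- Squared Vandermonde product. -/
noncomputable def hhD (m : ℕ) (x : Fin m → ℝ) : ℝ :=
  ∏ p ∈ Finset.univ.filter (fun p : Fin m × Fin m => p.1 < p.2), (x p.2 - x p.1) ^ 2

/-- Weight product. -/
noncomputable def hhW (m : ℕ) (x : Fin m → ℝ) : ℝ :=
  ∏ j : Fin m, (1 - x j) ^ (-(1/2) : ℝ) * (1 + x j) ^ (-(1/2) : ℝ)

/-- Cross product. -/
noncomputable def hhP (n r : ℕ) (X : Fin n → ℝ) (y : Fin r → ℝ) : ℝ :=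
  ∏ i : Fin n, ∏ k : Fin r, (y k - X i) ^ 2

/-- The open cube. -/
def hhU (m : ℕ) : Set (Fin m → ℝ) := Set.univ.pi fun _ => Set.Ioo (-1 : ℝ) 1

/-- The conditioning box. -/
def hhK (r : ℕ) (t : Fin r → ℝ) : Set (Fin r → ℝ) :=
  Set.univ.pi fun k => Set.Ico (1 - t k) 1

lemma hh_w_integrable :
    Integrable (fun x : ℝ => (1 - x) ^ (-(1/2) : ℝ) * (1 + x) ^ (-(1/2) : ℝ))
      (volume.restrict (Set.Ioo (-1 : ℝ) 1)) := by
  have h0 : IntervalIntegrable (fun x : ℝ => x ^ (-(1/2) : ℝ)) volume 0 2 :=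
    intervalIntegral.intervalIntegrable_rpow' (by norm_num)
  have h1 := h0.comp_sub_left 1
  have h2 := h0.comp_add_left 1
  norm_num at h1 h2
  have h1' := (intervalIntegrable_iff_integrableOn_Ioo_of_le (by norm_num)).1 h1.symm
  have h2' := (intervalIntegrable_iff_integrableOn_Ioo_of_le (by norm_num)).1 h2
  refine Integrable.mono' (h1'.add h2') ?_ ?_
  · exact Measurable.aestronglyMeasurable (by fun_prop)
  · filter_upwards [ae_restrict_mem measurableSet_Ioo] with x hx
    have ha : 0 < 1 - x := by linarith [hx.2]
    have hb : 0 < 1 + x := by linarith [hx.1]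
    have pa := rpow_pos_of_pos ha (-(1/2))
    have pb := rpow_pos_of_pos hb (-(1/2))
    rw [norm_of_nonneg (by positivity)]
    norm_num at pa pb ⊢
    rcases le_total 0 x with h | h
    · have : (1 + x) ^ (-(1/2) : ℝ) ≤ 1 := rpow_le_one_of_one_le_of_nonpos (by linarith) (by norm_num)
      norm_num at this
      nlinarith
    · have : (1 - x) ^ (-(1/2) : ℝ) ≤ 1 := rpow_le_one_of_one_le_of_nonpos (by linarith) (by norm_num)
      norm_num at this
      nlinarith

lemma hhU_meas (m : ℕ) : MeasurableSet (hhU m) :=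
  MeasurableSet.univ_pi fun _ => measurableSet_Ioo

lemma hhK_meas (m : ℕ) (t) : MeasurableSet (hhK m t) :=
  MeasurableSet.univ_pi fun _ => measurableSet_Ico

lemma hhD_cont (m : ℕ) : Continuous (hhD m) := by unfold hhD; fun_prop

lemma hhW_meas (m : ℕ) : Measurable (hhW m) := by unfold hhW; fun_prop

lemma hhP_cont (n r : ℕ) : Continuous (fun z : (Fin n → ℝ) × (Fin r → ℝ) => hhP n r z.1 z.2) := by
  unfold hhP; fun_prop

lemma hhD_nonneg (m : ℕ) (x) : 0 ≤ hhD m x := by unfold hhD; positivity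

lemma hhP_nonneg (n r : ℕ) (X y) : 0 ≤ hhP n r X y := by unfold hhP; positivity

lemma hhW_pos (m : ℕ) {x} (hx : x ∈ hhU m) : 0 < hhW m x := by
  unfold hhW
  refine Finset.prod_pos fun j _ => ?_
  have := hx j (Set.mem_univ j)
  exact mul_pos (rpow_pos_of_pos (by linarith [this.2]) _) (rpow_pos_of_pos (by linarith [this.1]) _)

lemma hhD_pos (m : ℕ) {x} (hx : Function.Injective x) : 0 < hhD m x := by
  unfold hhD
  refine Finset.prod_pos fun p hp => ?_
  have h := (Finset.mem_filter.1 hp).2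
  have : x p.2 - x p.1 ≠ 0 := sub_ne_zero.2 fun e => h.ne' (hx e)
  positivity

lemma hhD_bound (m : ℕ) {x} (hx : x ∈ hhU m) : ∃ c, c = (∏ p ∈ Finset.univ.filter (fun p : Fin m × Fin m => p.1 < p.2), (4:ℝ)) ∧ ‖hhD m x‖ ≤ c := by
  refine ⟨_, rfl, ?_⟩
  rw [norm_of_nonneg (hhD_nonneg _ _)]
  unfold hhD
  refine Finset.prod_le_prod (fun _ _ => sq_nonneg _) fun p _ => ?_
  have h1 := hx p.1 (Set.mem_univ _)
  have h2 := hx p.2 (Set.mem_univ _)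
  nlinarith [h1.1, h1.2, h2.1, h2.2]

lemma hhP_bound (n r : ℕ) {X y} (hx : X ∈ hhU n) (hy : ∀ k, y k ∈ Set.Ioo (-1:ℝ) 2) :
    ‖hhP n r X y‖ ≤ ∏ _i : Fin n, ∏ _k : Fin r, (9:ℝ) := by
  rw [norm_of_nonneg (hhP_nonneg _ _ _ _)]
  unfold hhP
  refine Finset.prod_le_prod (fun _ _ => by positivity) fun i _ => ?_
  refine Finset.prod_le_prod (fun _ _ => sq_nonneg _) fun k _ => ?_
  have h1 := hx i (Set.mem_univ _)
  have h2 := hy k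
  nlinarith [h1.1, h1.2, h2.1, h2.2]

lemma hhW_int (m : ℕ) : IntegrableOn (hhW m) (hhU m) := by
  unfold IntegrableOn hhU
  rw [volume_pi, Measure.restrict_pi_pi]
  exact Integrable.fintype_prod (fun _ => hh_w_integrable)

lemma hhDW_int (m : ℕ) : IntegrableOn (fun x => hhD m x * hhW m x) (hhU m) := by
  refine Integrable.bdd_mul (c := ∏ p ∈ Finset.univ.filter (fun p : Fin m × Fin m => p.1 < p.2), (4:ℝ))
    (hhW_int m) (hhD_cont m).aestronglyMeasurable ?_
  filter_upwards [ae_restrict_mem (hhU_meas m)] with x hx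
  obtain ⟨c, rfl, h⟩ := hhD_bound m hx
  exact h

lemma hhDW_meas (m : ℕ) : Measurable (fun x => hhD m x * hhW m x) :=
  (hhD_cont m).measurable.mul (hhW_meas m)

lemma hhK_sub (r : ℕ) {t : Fin r → ℝ} (ht : ∀ k, t k ∈ Set.Ioo (0:ℝ) 1) : hhK r t ⊆ hhU r := by
  intro y hy k hk
  have := hy k hk
  exact ⟨by linarith [this.1, (ht k).2], this.2⟩

/-- Inner integral. -/
noncomputable def hhG (n r : ℕ) (A : Set (Fin n → ℝ)) (y : Fin r → ℝ) : ℝ :=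
  ∫ X in A, (hhD n X * hhW n X) * hhP n r X y

lemma hhG_cont (n r : ℕ) (A : Set (Fin n → ℝ)) (hA : MeasurableSet A) (hAU : A ⊆ hhU n) :
    ContinuousAt (hhG n r A) (fun _ => 1) := by
  unfold hhG
  refine continuousAt_of_dominated
    (bound := fun X => (hhD n X * hhW n X) * ∏ _i : Fin n, ∏ _k : Fin r, (9:ℝ)) ?_ ?_ ?_ ?_
  · refine Eventually.of_forall fun y => Measurable.aestronglyMeasurable ?_
    refine (hhDW_meas n).mul ?_
    exact ((hhP_cont n r).comp (Continuous.prodMk_left y)).measurable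
  · have : ∀ᶠ y : Fin r → ℝ in nhds (fun _ => 1), ∀ k, y k ∈ Set.Ioo (-1:ℝ) 2 := by
      rw [eventually_all]
      intro k
      exact (continuous_apply k).continuousAt.eventually (Ioo_mem_nhds (by norm_num) (by norm_num))
    filter_upwards [this] with y hy
    filter_upwards [ae_restrict_mem hA] with X hX
    rw [norm_mul, norm_of_nonneg (mul_nonneg (hhD_nonneg n X) (hhW_pos n (hAU hX)).le)]
    exact mul_le_mul_of_nonneg_left (hhP_bound n r (hAU hX) hy)
      (mul_nonneg (hhD_nonneg n X) (hhW_pos n (hAU hX)).le)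
  · exact ((hhDW_int n).mono_set hAU).mul_const _
  · refine Eventually.of_forall fun X => Continuous.continuousAt ?_
    exact continuous_const.mul ((hhP_cont n r).comp (Continuous.prodMk_right X))

lemma hh_joint (n r : ℕ) (A : Set (Fin n → ℝ)) (hA : MeasurableSet A) (hAU : A ⊆ hhU n)
    (t : Fin r → ℝ) (ht : ∀ k, t k ∈ Set.Ioo (0:ℝ) 1) :
    Integrable (fun z : (Fin n → ℝ) × (Fin r → ℝ) =>
      hhP n r z.1 z.2 * ((hhD n z.1 * hhW n z.1) * (hhD r z.2 * hhW r z.2)))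
      ((volume.restrict A).prod (volume.restrict (hhK r t))) := by
  refine Integrable.bdd_mul (c := ∏ _i : Fin n, ∏ _k : Fin r, (9:ℝ))
    (Integrable.mul_prod ((hhDW_int n).mono_set hAU) ((hhDW_int r).mono_set (hhK_sub r ht)))
    (hhP_cont n r).aestronglyMeasurable ?_
  rw [Measure.prod_restrict]
  filter_upwards [ae_restrict_mem (hA.prod (hhK_meas r t))] with z hz
  refine hhP_bound n r (hAU hz.1) fun k => ?_
  have := hhK_sub r ht hz.2 k (Set.mem_univ k)
  exact ⟨this.1, by linarith [this.2]⟩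

lemma hh_inner (n r : ℕ) (A : Set (Fin n → ℝ)) (y : Fin r → ℝ) :
    ∫ X in A, hhP n r X y * ((hhD n X * hhW n X) * (hhD r y * hhW r y))
      = (hhD r y * hhW r y) * hhG n r A y := by
  unfold hhG
  rw [← integral_const_mul]
  congr 1
  ext X
  ring

lemma hhbG_int (n r : ℕ) (A : Set (Fin n → ℝ)) (hA : MeasurableSet A) (hAU : A ⊆ hhU n)
    (t : Fin r → ℝ) (ht : ∀ k, t k ∈ Set.Ioo (0:ℝ) 1) :
    IntegrableOn (fun y => (hhD r y * hhW r y) * hhG n r A y) (hhK r t) := by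
  have := (hh_joint n r A hA hAU t ht).integral_prod_right
  simp only [hh_inner] at this
  exact this

lemma hhD_split (n r : ℕ) (x : Fin (n + r) → ℝ) :
    hhD (n + r) x = hhD n (fun j => x (Fin.castAdd r j)) * hhD r (fun k => x (Fin.natAdd n k)) *
      hhP n r (fun j => x (Fin.castAdd r j)) (fun k => x (Fin.natAdd n k)) := by
  unfold hhD hhP
  have e1 : ∀ (i : Fin n) (k : Fin r), Fin.castAdd r i < Fin.natAdd n k := by
    intro i k; simp [Fin.lt_def]; omega
  have e2 : ∀ (i : Fin n) (k : Fin r), ¬ Fin.natAdd n k < Fin.castAdd r i := by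
    intro i k; exact (e1 i k).asymm
  have e3 : ∀ (i j : Fin n), Fin.castAdd r i < Fin.castAdd r j ↔ i < j := by
    intro i j; exact Iff.rfl
  have e4 : ∀ (i j : Fin r), Fin.natAdd n i < Fin.natAdd n j ↔ i < j := by
    intro i j; simp
  simp only [Finset.prod_filter, Fintype.prod_prod_type, Fin.prod_univ_add, e1, e2, e3, e4,
    if_true, if_false, Finset.prod_const_one, one_mul, Finset.prod_mul_distrib]
  ring

lemma hhW_split (n r : ℕ) (x : Fin (n + r) → ℝ) :
    hhW (n + r) x = hhW n (fun j => x (Fin.castAdd r j)) * hhW r (fun k => x (Fin.natAdd n k)) := by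
  unfold hhW
  rw [Fin.prod_univ_add]

/-- Measurable splitting of coordinates. -/
def hhE (n r : ℕ) : (Fin (n + r) → ℝ) ≃ᵐ (Fin n → ℝ) × (Fin r → ℝ) :=
  (MeasurableEquiv.piCongrLeft (fun _ : Fin (n + r) => ℝ) finSumFinEquiv).symm.trans
    (MeasurableEquiv.sumPiEquivProdPi (fun _ : Fin n ⊕ Fin r => ℝ))

lemma hhE_apply (n r : ℕ) (x : Fin (n + r) → ℝ) :
    hhE n r x = (fun j => x (Fin.castAdd r j), fun k => x (Fin.natAdd n k)) := by
  rfl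

lemma hhE_mp (n r : ℕ) : MeasurePreserving (hhE n r) volume volume :=
  ((volume_measurePreserving_piCongrLeft (fun _ : Fin (n + r) => ℝ) finSumFinEquiv).symm _).trans
    (volume_measurePreserving_sumPiEquivProdPi (fun _ : Fin n ⊕ Fin r => ℝ))

lemma hh_fubini (n r : ℕ) (A : Set (Fin n → ℝ)) (hA : MeasurableSet A) (hAU : A ⊆ hhU n)
    (t : Fin r → ℝ) (ht : ∀ k, t k ∈ Set.Ioo (0:ℝ) 1) :
    (∫ x : Fin (n + r) → ℝ in
            {x | (fun j => x (Fin.castAdd r j)) ∈ A ∧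
                 ∀ k : Fin r, x (Fin.natAdd n k) ∈ Set.Ico (1 - t k) 1},
          hhD (n + r) x * hhW (n + r) x) =
      ∫ y in hhK r t, (hhD r y * hhW r y) * hhG n r A y := by
  have h1 : {x : Fin (n + r) → ℝ | (fun j => x (Fin.castAdd r j)) ∈ A ∧
      ∀ k : Fin r, x (Fin.natAdd n k) ∈ Set.Ico (1 - t k) 1} = hhE n r ⁻¹' (A ×ˢ hhK r t) := by
    ext x
    simp [hhE_apply, hhK, Set.mem_pi]
  have h2 : ∀ x, hhD (n + r) x * hhW (n + r) x = (fun z : (Fin n → ℝ) × (Fin r → ℝ) =>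
      hhP n r z.1 z.2 * ((hhD n z.1 * hhW n z.1) * (hhD r z.2 * hhW r z.2))) (hhE n r x) := by
    intro x
    rw [hhD_split, hhW_split, hhE_apply]
    ring
  rw [h1]
  rw [integral_congr_ae (Eventually.of_forall h2)]
  rw [(hhE_mp n r).setIntegral_preimage_emb (hhE n r).measurableEmbedding
      (fun z : (Fin n → ℝ) × (Fin r → ℝ) =>
        hhP n r z.1 z.2 * ((hhD n z.1 * hhW n z.1) * (hhD r z.2 * hhW r z.2))),
    Measure.volume_eq_prod, ← Measure.prod_restrict,
    integral_prod_symm _ (hh_joint n r A hA hAU t ht)]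
  simp only [hh_inner]

lemma hh_pos (m : ℕ) (t : Fin m → ℝ) (ht : ∀ k, 0 < t k) (S : Set (Fin m → ℝ))
    (g : (Fin m → ℝ) → ℝ) (hS : MeasurableSet S) (hg : IntegrableOn g S) (h0 : ∀ x ∈ S, 0 ≤ g x)
    (hsub : (Set.univ.pi fun k => Set.Ioo (1 - t k) 1) ⊆ S)
    (hp : ∀ x ∈ (Set.univ.pi fun k => Set.Ioo (1 - t k) 1), Function.Injective x → 0 < g x) :
    0 < ∫ x in S, g x := by
  rw [setIntegral_pos_iff_support_of_nonneg_ae]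
  · set O : Set (Fin m → ℝ) := (Set.univ.pi fun k => Set.Ioo (1 - t k) 1) ∩ {x | hhD m x ≠ 0}
    have hO : IsOpen O := (isOpen_set_pi Set.finite_univ fun _ _ => isOpen_Ioo).inter
      (isOpen_ne_fun (hhD_cont m) continuous_const)
    have hinj : ∀ x, hhD m x ≠ 0 → Function.Injective x := by
      intro x hx i j hij
      by_contra hne
      apply hx
      unfold hhD
      rcases lt_or_gt_of_ne hne with h | h
      · exact Finset.prod_eq_zero (i := (i, j)) (by simp [h]) (by simp [hij])
      · exact Finset.prod_eq_zero (i := (j, i)) (by simp [h]) (by simp [hij])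
    have hne : O.Nonempty := by
      obtain ⟨δ, hδ, hlt⟩ : ∃ δ > 0, ∀ k, δ < t k := by
        have : ∀ᶠ δ : ℝ in nhdsWithin 0 (Set.Ioi 0), ∀ k, δ < t k := by
          rw [eventually_all]
          intro k
          exact mem_nhdsWithin_of_mem_nhds (Iio_mem_nhds (ht k))
        obtain ⟨δ, h1, h2⟩ := (this.and self_mem_nhdsWithin).exists
        exact ⟨δ, h2, h1⟩
      refine ⟨fun k => 1 - δ / ((k : ℕ) + 1 : ℝ), ?_, ?_⟩
      · intro k _
        have hk : (0:ℝ) < (k:ℕ) + 1 := by positivity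
        have : δ / ((k : ℕ) + 1 : ℝ) ≤ δ := div_le_self hδ.le (by simp)
        have : 0 < δ / ((k : ℕ) + 1 : ℝ) := by positivity
        constructor <;> dsimp only <;> linarith [hlt k]
      · refine (hhD_pos m ?_).ne'
        intro i j hij
        have h1 : ((i:ℕ) + 1 : ℝ) ≠ 0 := by positivity
        have h2 : ((j:ℕ) + 1 : ℝ) ≠ 0 := by positivity
        have h3 : δ / ((i : ℕ) + 1 : ℝ) = δ / ((j : ℕ) + 1 : ℝ) := by
          simp only at hij; linarith
        rw [div_eq_div_iff h1 h2] at h3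
        have h4 := mul_left_cancel₀ hδ.ne' h3
        have h5 : ((i:ℕ):ℝ) = (j:ℕ) := by linarith
        exact Fin.ext (by exact_mod_cast h5)
    refine lt_of_lt_of_le (hO.measure_pos volume hne) (measure_mono ?_)
    intro x hx
    exact ⟨(hp x hx.1 (hinj x hx.2)).ne', hsub hx.1⟩
  · filter_upwards [ae_restrict_mem hS] with x hx using h0 x hx
  · exact hg

lemma hhb_pos (r : ℕ) (t : Fin r → ℝ) (ht : ∀ k, t k ∈ Set.Ioo (0:ℝ) 1) :
    0 < ∫ y in hhK r t, hhD r y * hhW r y := by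
  have hs := hhK_sub r ht
  refine hh_pos r t (fun k => (ht k).1) _ _ (hhK_meas r t) ((hhDW_int r).mono_set hs) ?_ ?_ ?_
  · intro x hx
    exact mul_nonneg (hhD_nonneg r x) (hhW_pos r (hs hx)).le
  · exact Set.pi_mono fun k _ => Set.Ioo_subset_Ico_self
  · intro x hx hi
    exact mul_pos (hhD_pos r hi)
      (hhW_pos r (hs ((Set.pi_mono fun k _ => Set.Ioo_subset_Ico_self) hx)))

lemma hhP_one (n r : ℕ) {X : Fin n → ℝ} (hX : X ∈ hhU n) :
    (hhD n X * hhW n X) * hhP n r X (fun _ => 1) =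
      (∏ p ∈ Finset.univ.filter (fun p : Fin n × Fin n => p.1 < p.2), (X p.2 - X p.1) ^ 2) *
        ∏ j : Fin n, (1 - X j) ^ ((2 * r : ℝ) - 1/2) * (1 + X j) ^ (-(1/2) : ℝ) := by
  unfold hhD hhW hhP
  rw [mul_assoc, ← Finset.prod_mul_distrib]
  congr 1
  refine Finset.prod_congr rfl fun j _ => ?_
  have h := hX j (Set.mem_univ j)
  have h1 : 0 < 1 - X j := by linarith [h.2]
  have : (1 - X j) ^ ((2 * r : ℝ) - 1/2) = (1 - X j) ^ (-(1/2) : ℝ) * ((1 - X j) ^ 2) ^ r := by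
    rw [← pow_mul, ← rpow_natCast, ← rpow_add h1]
    congr 1
    push_cast
    ring
  rw [this]
  simp only [Finset.prod_const, Finset.card_univ, Fintype.card_fin]
  ring

lemma hhG_one (n r : ℕ) (A : Set (Fin n → ℝ)) (hA : MeasurableSet A) (hAU : A ⊆ hhU n) :
    hhG n r A (fun _ => 1) = ∫ X in A,
      (∏ p ∈ Finset.univ.filter (fun p : Fin n × Fin n => p.1 < p.2), (X p.2 - X p.1) ^ 2) *
        ∏ j : Fin n, (1 - X j) ^ ((2 * r : ℝ) - 1/2) * (1 + X j) ^ (-(1/2) : ℝ) :=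
  setIntegral_congr_fun hA fun _ hX => hhP_one n r (hAU hX)

lemma hhG_pos (n r : ℕ) : 0 < hhG n r (hhU n) (fun _ => 1) := by
  unfold hhG
  have hs : (Set.univ.pi fun _ : Fin n => Set.Ioo (1 - 1 : ℝ) 1) ⊆ hhU n :=
    Set.pi_mono fun k _ => Set.Ioo_subset_Ioo (by norm_num) le_rfl
  refine hh_pos n (fun _ => 1) (fun _ => one_pos) _ _ (hhU_meas n) ?_ ?_ hs ?_
  · refine Integrable.mul_bdd (c := ∏ _i : Fin n, ∏ _k : Fin r, (9:ℝ)) (hhDW_int n) ?_ ?_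
    · exact ((hhP_cont n r).comp (Continuous.prodMk_left _)).aestronglyMeasurable
    · filter_upwards [ae_restrict_mem (hhU_meas n)] with X hX
      exact hhP_bound n r hX fun k => ⟨by norm_num, by norm_num⟩
  · intro x hx
    exact mul_nonneg (mul_nonneg (hhD_nonneg n x) (hhW_pos n hx).le) (hhP_nonneg _ _ _ _)
  · intro x hx hi
    refine mul_pos (mul_pos (hhD_pos n hi) (hhW_pos n (hs hx))) ?_
    unfold hhP
    refine Finset.prod_pos fun i _ => Finset.prod_pos fun k _ => ?_
    have := (hx i (Set.mem_univ i)).2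
    have : 0 < 1 - x i := by linarith
    positivity

lemma hh_avg (n r : ℕ) (A : Set (Fin n → ℝ)) (hA : MeasurableSet A) (hAU : A ⊆ hhU n) :
    Tendsto (fun t : Fin r → ℝ => (∫ y in hhK r t, (hhD r y * hhW r y) * hhG n r A y) /
        ∫ y in hhK r t, hhD r y * hhW r y)
      (nhdsWithin 0 (Set.univ.pi fun _ : Fin r => Set.Ioo (0 : ℝ) 1))
      (nhds (hhG n r A (fun _ => 1))) := by
  rw [Metric.tendsto_nhds]
  intro ε hε
  obtain ⟨δ, hδ, hG⟩ := Metric.continuousAt_iff.1 (hhG_cont n r A hA hAU) (ε / 2) (by positivity)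
  have hev : ∀ᶠ t : Fin r → ℝ in nhdsWithin 0 (Set.univ.pi fun _ : Fin r => Set.Ioo (0 : ℝ) 1),
      dist t 0 < δ := mem_nhdsWithin_of_mem_nhds (Metric.ball_mem_nhds 0 hδ)
  filter_upwards [hev, self_mem_nhdsWithin] with t htd ht'
  have ht : ∀ k, t k ∈ Set.Ioo (0:ℝ) 1 := fun k => ht' k (Set.mem_univ k)
  have hb := hhb_pos r t ht
  have hbi := (hhDW_int r).mono_set (hhK_sub r ht)
  set c := hhG n r A (fun _ => 1)
  rw [dist_eq_norm]
  have e : (∫ y in hhK r t, (hhD r y * hhW r y) * hhG n r A y) /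
        (∫ y in hhK r t, hhD r y * hhW r y) - c =
      (∫ y in hhK r t, (hhD r y * hhW r y) * (hhG n r A y - c)) /
        ∫ y in hhK r t, hhD r y * hhW r y := by
    have : (∫ y in hhK r t, (hhD r y * hhW r y) * (hhG n r A y - c)) =
        (∫ y in hhK r t, (hhD r y * hhW r y) * hhG n r A y) -
          (∫ y in hhK r t, hhD r y * hhW r y) * c := by
      rw [← integral_mul_const, ← integral_sub (hhbG_int n r A hA hAU t ht) (hbi.mul_const c)]
      congr 1
      ext y
      ring
    rw [this]
    field_simp
  rw [e, norm_div, norm_of_nonneg hb.le, div_lt_iff₀ hb]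
  have hle : ‖∫ y in hhK r t, (hhD r y * hhW r y) * (hhG n r A y - c)‖ ≤
      ∫ y in hhK r t, (hhD r y * hhW r y) * (ε / 2) := by
    refine norm_integral_le_of_norm_le (hbi.mul_const _) ?_
    filter_upwards [ae_restrict_mem (hhK_meas r t)] with y hy
    have hn := mul_nonneg (hhD_nonneg r y) (hhW_pos r (hhK_sub r ht hy)).le
    rw [norm_mul, norm_of_nonneg hn]
    refine mul_le_mul_of_nonneg_left ?_ hn
    rw [← dist_eq_norm]
    refine (hG ?_).le
    rw [dist_pi_lt_iff hδ]
    intro k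
    have h1 := hy k (Set.mem_univ k)
    have h2 := (dist_pi_lt_iff hδ).1 htd k
    rw [Real.dist_eq, abs_lt] at h2 ⊢
    simp only [Pi.zero_apply] at h2
    constructor <;> linarith [h1.1, h1.2, h2.1, h2.2]
  rw [integral_mul_const] at hle
  nlinarith

/-- Conditioning `r` of the `N = n + r` levels of the SO(2N) eigenvalue density
to lie in shrinking neighborhoods `[1 - t_k, 1)` of `1` yields, in the limit
`t → 0+`, the eigenvalue measure of the `2r`-hard ensemble `SO^{(2r)}(2N)`:
the weight exponent at the edge `+1` is raised from `-1/2` to `2r - 1/2`. -/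
theorem so_even_hard_edge_conditioning (n r : ℕ) (hn : 1 ≤ n) (hr : 1 ≤ r)
    (J : Set (Fin n → ℝ)) (hJ : MeasurableSet J)
    (hJsub : J ⊆ Set.univ.pi fun _ => Set.Ioo (-1 : ℝ) 1) :
    Filter.Tendsto
      (fun t : Fin r → ℝ =>
        (∫ x : Fin (n + r) → ℝ in
            {x | (fun j => x (Fin.castAdd r j)) ∈ J ∧
                 ∀ k : Fin r, x (Fin.natAdd n k) ∈ Set.Ico (1 - t k) 1},
          (∏ p ∈ Finset.univ.filter
              (fun p : Fin (n + r) × Fin (n + r) => p.1 < p.2),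
            (x p.2 - x p.1) ^ 2) *
            ∏ j : Fin (n + r),
              (1 - x j) ^ (-(1/2) : ℝ) * (1 + x j) ^ (-(1/2) : ℝ)) /
        (∫ x : Fin (n + r) → ℝ in
            {x | (fun j => x (Fin.castAdd r j)) ∈
                   Set.univ.pi (fun _ : Fin n => Set.Ioo (-1 : ℝ) 1) ∧
                 ∀ k : Fin r, x (Fin.natAdd n k) ∈ Set.Ico (1 - t k) 1},
          (∏ p ∈ Finset.univ.filter
              (fun p : Fin (n + r) × Fin (n + r) => p.1 < p.2),
            (x p.2 - x p.1) ^ 2) *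
            ∏ j : Fin (n + r),
              (1 - x j) ^ (-(1/2) : ℝ) * (1 + x j) ^ (-(1/2) : ℝ)))
      (nhdsWithin 0 (Set.univ.pi fun _ : Fin r => Set.Ioo (0 : ℝ) 1))
      (nhds
        ((∫ X : Fin n → ℝ in J,
            (∏ p ∈ Finset.univ.filter
                (fun p : Fin n × Fin n => p.1 < p.2),
              (X p.2 - X p.1) ^ 2) *
              ∏ j : Fin n,
                (1 - X j) ^ ((2 * r : ℝ) - 1/2) * (1 + X j) ^ (-(1/2) : ℝ)) /
         (∫ X : Fin n → ℝ in Set.univ.pi (fun _ : Fin n => Set.Ioo (-1 : ℝ) 1),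
            (∏ p ∈ Finset.univ.filter
                (fun p : Fin n × Fin n => p.1 < p.2),
              (X p.2 - X p.1) ^ 2) *
              ∏ j : Fin n,
                (1 - X j) ^ ((2 * r : ℝ) - 1/2) * (1 + X j) ^ (-(1/2) : ℝ)))) := by
  have hU := hh_avg n r (hhU n) (hhU_meas n) subset_rfl
  have hA := hh_avg n r J hJ hJsub
  have h := hA.div hU (hhG_pos n r).ne'
  rw [hhG_one n r J hJ hJsub, hhG_one n r (hhU n) (hhU_meas n) subset_rfl] at h
  refine Tendsto.congr' ?_ h
  filter_upwards [self_mem_nhdsWithin] with t ht'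
  have ht : ∀ k, t k ∈ Set.Ioo (0:ℝ) 1 := fun k => ht' k (Set.mem_univ k)
  have hb := hhb_pos r t ht
  have e1 := hh_fubini n r J hJ hJsub t ht
  have e2 := hh_fubini n r (hhU n) (hhU_meas n) subset_rfl t ht
  simp only [Pi.div_apply]
  rw [div_div_div_cancel_right₀ hb.ne', ← e1, ← e2]
  rfl
end

section
/- Let N > r ≥ 1 be natural numbers and define f : (−1,1)^N → ℝ by f(x₁,…,x_N) = ∏_{1≤j<k≤N}(x_k − x_j)² · ∏_{1≤j≤N}(1 − x_j)^{1/2}(1 + x_j)^{−1/2}. For t = (t₁,…,t_r) ∈ (0,1)^r let K(t) = ∏_{k=1}^r [1 − t_k, 1). Then for every Borel set J ⊆ (−1,1)^{N−r}, as t → 0 (each t_k → 0 from the right), the conditional probability F(t) = (∫_{J × K(t)} f dx) / (∫_{(−1,1)^{N−r} × K(t)} f dx) converges to (∫_J ∏_{1≤j<k≤N−r}(x_k − x_j)² · ∏_{1≤j≤N−r}(1 − x_j)^{2r + 1/2}(1 + x_j)^{−1/2} dx) / (∫_{(−1,1)^{N−r}} ∏_{1≤j<k≤N−r}(x_k − x_j)²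 · ∏_{1≤j≤N−r}(1 − x_j)^{2r + 1/2}(1 + x_j)^{−1/2} dx). -/
open MeasureTheory Real Finset Filter

namespace HardEdge

/-- Squared Vandermonde product. -/
noncomputable def V (n : ℕ) (x : Fin n → ℝ) : ℝ :=
  ∏ p ∈ Finset.univ.filter (fun p : Fin n × Fin n => p.1 < p.2), (x p.2 - x p.1) ^ 2

/-- Jacobi weight. -/
noncomputable def W (c : ℝ) (n : ℕ) (x : Fin n → ℝ) : ℝ :=
  ∏ j : Fin n, (1 - x j) ^ c * (1 + x j) ^ (-(1/2) : ℝ)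

/-- Cross product. -/
noncomputable def P (n r : ℕ) (x : Fin n → ℝ) (y : Fin r → ℝ) : ℝ :=
  ∏ j : Fin n, ∏ k : Fin r, (y k - x j) ^ 2

def box (n : ℕ) : Set (Fin n → ℝ) := Set.univ.pi fun _ => Set.Ioo (-1 : ℝ) 1

def cbox (n : ℕ) : Set (Fin n → ℝ) := Set.univ.pi fun _ => Set.Icc (-1 : ℝ) 1

def K {r : ℕ} (t : Fin r → ℝ) : Set (Fin r → ℝ) := Set.univ.pi fun k => Set.Ico (1 - t k) 1

lemma box_sub (n : ℕ) : box n ⊆ cbox n :=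
  Set.pi_mono fun _ _ => Set.Ioo_subset_Icc_self

lemma cbox_compact (n : ℕ) : IsCompact (cbox n) :=
  isCompact_univ_pi fun _ => isCompact_Icc

lemma box_meas (n : ℕ) : MeasurableSet (box n) :=
  MeasurableSet.univ_pi fun _ => measurableSet_Ioo

lemma K_meas {r : ℕ} (t : Fin r → ℝ) : MeasurableSet (K t) :=
  MeasurableSet.univ_pi fun _ => measurableSet_Ico

lemma V_cont (n : ℕ) : Continuous (V n) := by unfold V; fun_prop

lemma P_cont (n r : ℕ) : Continuous (fun z : (Fin n → ℝ) × (Fin r → ℝ) => P n r z.1 z.2) := by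
  unfold P; fun_prop

lemma V_nonneg (n : ℕ) (x) : 0 ≤ V n x := Finset.prod_nonneg fun _ _ => sq_nonneg _

lemma W_nonneg (c : ℝ) (n : ℕ) (x) (hx : x ∈ cbox n) : 0 ≤ W c n x := by
  refine Finset.prod_nonneg fun j _ => ?_
  have := hx j (Set.mem_univ _)
  exact mul_nonneg (rpow_nonneg (by linarith [this.2]) _) (rpow_nonneg (by linarith [this.1]) _)

lemma W_pos (c : ℝ) (n : ℕ) (x) (hx : x ∈ box n) : 0 < W c n x := by
  refine Finset.prod_pos fun j _ => ?_
  have := hx j (Set.mem_univ _)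
  exact mul_pos (rpow_pos_of_pos (by linarith [this.2]) _) (rpow_pos_of_pos (by linarith [this.1]) _)

lemma V_eq (n : ℕ) (x : Fin n → ℝ) :
    V n x = ∏ i, ∏ j, if i < j then (x j - x i) ^ 2 else 1 := by
  rw [V, Finset.prod_filter, ← Finset.univ_product_univ, Finset.prod_product]

lemma V_split (n r : ℕ) (x : Fin (n + r) → ℝ) :
    V (n + r) x = V n (fun j => x (Fin.castAdd r j)) * V r (fun k => x (Fin.natAdd n k)) *
      P n r (fun j => x (Fin.castAdd r j)) (fun k => x (Fin.natAdd n k)) := by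
  have h1 : ∀ (i : Fin n) (j : Fin r), Fin.castAdd r i < Fin.natAdd n j := by
    intro i j; rw [Fin.lt_def]; simp; omega
  have h2 : ∀ (i : Fin n) (j : Fin r), ¬ Fin.natAdd n j < Fin.castAdd r i := by
    intro i j; exact (h1 i j).asymm
  have h3 : ∀ (i j : Fin n), Fin.castAdd r i < Fin.castAdd r j ↔ i < j := by
    intro i j; rw [Fin.lt_def, Fin.lt_def]; simp
  have h4 : ∀ (i j : Fin r), Fin.natAdd n i < Fin.natAdd n j ↔ i < j := by
    intro i j; rw [Fin.lt_def, Fin.lt_def]; simp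
  simp only [V_eq, P, Fin.prod_univ_add, h1, h2, h3, h4, if_true, if_false, Finset.prod_const_one,
    Finset.prod_mul_distrib, one_mul]
  ring

lemma W_split (c : ℝ) (n r : ℕ) (x : Fin (n + r) → ℝ) :
    W c (n + r) x = W c n (fun j => x (Fin.castAdd r j)) * W c r (fun k => x (Fin.natAdd n k)) := by
  simp only [W, Fin.prod_univ_add]

lemma w_int (c : ℝ) (hc : 0 ≤ c) :
    IntegrableOn (fun x : ℝ => (1 - x) ^ c * (1 + x) ^ (-(1/2) : ℝ)) (Set.Ioo (-1) 1) := by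
  have h1 : IntegrableOn (fun x : ℝ => (1 + x) ^ (-(1/2) : ℝ)) (Set.Ioo (-1) 1) := by
    have h := (intervalIntegral.intervalIntegrable_rpow' (a := 0) (b := 2)
      (r := -(1/2)) (by norm_num)).comp_add_left 1
    norm_num at h
    have h' := (intervalIntegrable_iff_integrableOn_Ioo_of_le (by norm_num)).1 h
    convert h' using 3
  refine Integrable.bdd_mul (c := 2 ^ c) h1 ?_ ?_
  · exact (Continuous.rpow_const (by fun_prop) (fun _ => Or.inr hc)).aestronglyMeasurable
  · filter_upwards [ae_restrict_mem measurableSet_Ioo] with x hx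
    rw [Real.norm_of_nonneg (rpow_nonneg (by linarith [hx.2]) _)]
    exact rpow_le_rpow (by linarith [hx.2]) (by linarith [hx.1]) hc

lemma W_int (c : ℝ) (hc : 0 ≤ c) (n : ℕ) : IntegrableOn (W c n) (box n) := by
  have h := Integrable.fintype_prod (ι := Fin n) (𝕜 := ℝ)
    (f := fun _ x => (1 - x) ^ c * (1 + x) ^ (-(1/2) : ℝ))
    (μ := fun _ => volume.restrict (Set.Ioo (-1 : ℝ) 1)) (fun _ => w_int c hc)
  rw [← Measure.restrict_pi_pi] at h
  exact h

lemma VW_int (c : ℝ) (hc : 0 ≤ c) (n : ℕ) : IntegrableOn (fun x => V n x * W c n x) (box n) := by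
  obtain ⟨C, hC⟩ := (cbox_compact n).exists_bound_of_continuousOn (V_cont n).continuousOn
  refine Integrable.bdd_mul (c := C) (W_int c hc n) (V_cont n).aestronglyMeasurable ?_
  filter_upwards [ae_restrict_mem (box_meas n)] with x hx
  exact hC x (box_sub n hx)

lemma VW_pos (c : ℝ) (hc : 0 ≤ c) (n : ℕ) (t : Fin n → ℝ) (ht : ∀ k, 0 < t k)
    (S : Set (Fin n → ℝ)) (hS : MeasurableSet S) (hSb : S ⊆ box n)
    (hS' : (Set.univ.pi fun k => Set.Ioo (1 - t k) 1) ⊆ S) :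
    0 < ∫ x in S, V n x * W c n x := by
  rw [setIntegral_pos_iff_support_of_nonneg_ae ?_ ((VW_int c hc n).mono_set hSb)]
  swap
  · filter_upwards [ae_restrict_mem hS] with x hx
    exact mul_nonneg (V_nonneg n x) (W_nonneg c n x (box_sub n (hSb hx)))
  let U : Set (Fin n → ℝ) := (Set.univ.pi fun k => Set.Ioo (1 - t k) 1) ∩ {x | V n x ≠ 0}
  have hU : IsOpen U := (isOpen_set_pi Set.finite_univ fun _ _ => isOpen_Ioo).inter
    (isOpen_ne_fun (V_cont n) continuous_const)
  have hne : U.Nonempty := by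
    have hev : ∀ᶠ m in nhdsWithin (0 : ℝ) (Set.Ioi 0), ∀ k, m < t k :=
      eventually_all.2 fun k => nhdsWithin_le_nhds (Iio_mem_nhds (ht k))
    obtain ⟨m, hm, hm0⟩ := (hev.and self_mem_nhdsWithin).exists
    have hm0 : 0 < m := hm0
    refine ⟨fun k => 1 - m / ((k : ℕ) + 2), ?_, ?_⟩
    · intro k _
      have h2 : (0 : ℝ) < (k : ℕ) + 2 := by positivity
      have h3 : m / ((k : ℕ) + 2) ≤ m := div_le_self hm0.le (by
        have : (0 : ℝ) ≤ (k : ℕ) := by positivity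
        linarith)
      have h4 : 0 < m / ((k : ℕ) + 2) := by positivity
      have := hm k
      constructor <;> simp only <;> linarith
    · refine Finset.prod_ne_zero_iff.2 fun p hp => pow_ne_zero _ ?_
      have hp := (Finset.mem_filter.1 hp).2
      have hp' : (p.1 : ℕ) < (p.2 : ℕ) := hp
      have hp'' : ((p.1 : ℕ) : ℝ) < ((p.2 : ℕ) : ℝ) := by exact_mod_cast hp'
      have : m / (((p.2 : ℕ) : ℝ) + 2) < m / (((p.1 : ℕ) : ℝ) + 2) :=
        div_lt_div_of_pos_left hm0 (by positivity) (by linarith)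
      simp only
      intro h
      linarith
  refine (hU.measure_pos volume hne).trans_le (measure_mono ?_)
  intro x hx
  have hxS := hS' hx.1
  exact ⟨mul_ne_zero hx.2 (W_pos c n x (hSb hxS)).ne', hxS⟩

/-- Splitting the coordinates. -/
def e (n r : ℕ) : (Fin (n + r) → ℝ) ≃ᵐ (Fin n → ℝ) × (Fin r → ℝ) :=
  (MeasurableEquiv.piCongrLeft (fun _ => ℝ) finSumFinEquiv).symm.trans
    (MeasurableEquiv.sumPiEquivProdPi fun _ => ℝ)

lemma e_apply (n r : ℕ) (x) :
    e n r x = (fun j => x (Fin.castAdd r j), fun k => x (Fin.natAdd n k)) := rfl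

lemma e_mp (n r : ℕ) : MeasurePreserving (e n r) volume volume :=
  (volume_measurePreserving_sumPiEquivProdPi (fun _ => ℝ)).comp
    ((volume_measurePreserving_piCongrLeft (fun _ => ℝ) finSumFinEquiv).symm)

/-- The split integrand. -/
noncomputable def F (n r : ℕ) (z : (Fin n → ℝ) × (Fin r → ℝ)) : ℝ :=
  P n r z.1 z.2 * ((V n z.1 * W (1/2) n z.1) * (V r z.2 * W (1/2) r z.2))

lemma F_int (n r : ℕ) : Integrable (F n r) ((volume.restrict (box n)).prod (volume.restrict (box r))) := by
  obtain ⟨C, hC⟩ := ((cbox_compact n).prod (cbox_compact r)).exists_bound_of_continuousOn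
    (P_cont n r).continuousOn
  refine Integrable.bdd_mul (c := C)
    ((VW_int (1/2) (by norm_num) n).mul_prod (VW_int (1/2) (by norm_num) r))
    (P_cont n r).aestronglyMeasurable ?_
  rw [Measure.prod_restrict]
  filter_upwards [ae_restrict_mem ((box_meas n).prod (box_meas r))] with x hx
  exact hC x ⟨box_sub n hx.1, box_sub r hx.2⟩

lemma F_int' (n r : ℕ) (S T) (hS : S ⊆ box n) (hT : T ⊆ box r) :
    Integrable (F n r) ((volume.restrict S).prod (volume.restrict T)) := by
  have := F_int n r
  rw [Measure.prod_restrict] at this ⊢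
  exact IntegrableOn.mono_set this (Set.prod_mono hS hT)

/-- Inner integral. -/
noncomputable def G (n r : ℕ) (S : Set (Fin n → ℝ)) (y : Fin r → ℝ) : ℝ :=
  ∫ x in S, P n r x y * (V n x * W (1/2) n x)

lemma inner_eq (n r : ℕ) (S : Set (Fin n → ℝ)) (y : Fin r → ℝ) :
    ∫ x in S, F n r (x, y) = G n r S y * (V r y * W (1/2) r y) := by
  simp only [F, G, ← mul_assoc]
  rw [← integral_mul_const, ← integral_mul_const]

lemma num_eq (n r : ℕ) (S : Set (Fin n → ℝ)) (t : Fin r → ℝ) :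
    (∫ x : Fin (n + r) → ℝ in
      {x | (fun j => x (Fin.castAdd r j)) ∈ S ∧
        ∀ k : Fin r, x (Fin.natAdd n k) ∈ Set.Ico (1 - t k) 1},
      V (n + r) x * W (1/2) (n + r) x) =
    ∫ z, F n r z ∂((volume.restrict S).prod (volume.restrict (K t))) := by
  rw [Measure.prod_restrict]
  have h := (e_mp n r).setIntegral_preimage_emb (e n r).measurableEmbedding (F n r) (S ×ˢ K t)
  rw [← Measure.volume_eq_prod, ← h]
  have hset : {x : Fin (n + r) → ℝ | (fun j => x (Fin.castAdd r j)) ∈ S ∧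
        ∀ k : Fin r, x (Fin.natAdd n k) ∈ Set.Ico (1 - t k) 1} = e n r ⁻¹' (S ×ˢ K t) := by
    ext x
    simp [e_apply, K]
  rw [hset]
  congr 1
  funext x
  rw [V_split, W_split, e_apply, F]
  ring

lemma G_one (n r : ℕ) (S : Set (Fin n → ℝ)) (hSm : MeasurableSet S) (hS : S ⊆ box n) :
    G n r S 1 = ∫ x in S, V n x * W (2 * r + 1/2) n x := by
  refine setIntegral_congr_fun hSm fun x hx => ?_
  simp only [P, W, Pi.one_apply, Finset.prod_const, Finset.card_univ, Fintype.card_fin]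
  rw [mul_left_comm, ← Finset.prod_mul_distrib]
  congr 1
  refine Finset.prod_congr rfl fun j _ => ?_
  have hj := hS hx j (Set.mem_univ _)
  have h1 : 0 < 1 - x j := by linarith [hj.2]
  rw [rpow_add h1, ← pow_mul, ← mul_assoc]
  congr 2
  rw [← rpow_natCast]
  push_cast
  ring_nf

lemma G_lim (n r : ℕ) (S : Set (Fin n → ℝ)) (hSm : MeasurableSet S) (hS : S ⊆ box n) :
    Tendsto (G n r S) (nhdsWithin 1 (cbox r))
      (nhds (∫ x in S, V n x * W (2 * r + 1/2) n x)) := by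
  obtain ⟨C, hC⟩ := ((cbox_compact n).prod (cbox_compact r)).exists_bound_of_continuousOn
    (P_cont n r).continuousOn
  have hi : IntegrableOn (fun x => V n x * W (1/2) n x) S :=
    (VW_int (1/2) (by norm_num) n).mono_set hS
  have hcx : ∀ y, Continuous fun x => P n r x y := fun y => by unfold P; fun_prop
  have hcy : ∀ x, Continuous fun y => P n r x y := fun x => by unfold P; fun_prop
  have hlim := G_one n r S hSm hS
  rw [← hlim]
  unfold G
  refine tendsto_integral_filter_of_dominated_convergence
    (F := fun y x => P n r x y * (V n x * W (1/2) n x))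
    (f := fun x => P n r x 1 * (V n x * W (1/2) n x))
    (fun x => C * ‖V n x * W (1/2) n x‖) ?_ ?_ (hi.norm.const_mul C) ?_
  · exact Eventually.of_forall fun y => (hcx y).aestronglyMeasurable.mul hi.aestronglyMeasurable
  · filter_upwards [self_mem_nhdsWithin] with y hy
    filter_upwards [ae_restrict_mem hSm] with x hx
    rw [norm_mul]
    exact mul_le_mul_of_nonneg_right (hC (x, y) ⟨box_sub n (hS hx), hy⟩) (norm_nonneg _)
  · refine Eventually.of_forall fun x => ?_
    have h1 : Tendsto (fun y => P n r x y) (nhdsWithin 1 (cbox r)) (nhds (P n r x 1)) :=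
      ((hcy x).tendsto 1).mono_left nhdsWithin_le_nhds
    exact h1.mul_const (V n x * W (1/2) n x)

lemma avg (n r : ℕ) (S : Set (Fin n → ℝ)) (hSm : MeasurableSet S) (hS : S ⊆ box n) :
    Tendsto (fun t : Fin r → ℝ =>
      (∫ z, F n r z ∂((volume.restrict S).prod (volume.restrict (K t)))) /
        ∫ y in K t, V r y * W (1/2) r y)
      (nhdsWithin 0 (Set.univ.pi fun _ : Fin r => Set.Ioo (0 : ℝ) 1))
      (nhds (∫ x in S, V n x * W (2 * r + 1/2) n x)) := by
  set L := ∫ x in S, V n x * W (2 * r + 1/2) n x with hL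
  rw [Metric.tendsto_nhds]
  intro ε hε
  have hG := (Metric.tendsto_nhds.1 (G_lim n r S hSm hS)) (ε / 2) (by positivity)
  rw [← hL, eventually_nhdsWithin_iff, Metric.eventually_nhds_iff] at hG
  obtain ⟨δ, hδ, hG⟩ := hG
  have hb : ∀ᶠ t in nhdsWithin (0 : Fin r → ℝ) (Set.univ.pi fun _ : Fin r => Set.Ioo (0 : ℝ) 1),
      dist t 0 < δ := nhdsWithin_le_nhds (Metric.ball_mem_nhds _ hδ)
  filter_upwards [self_mem_nhdsWithin, hb] with t ht htδ
  have ht : ∀ k, 0 < t k ∧ t k < 1 := fun k => ht k (Set.mem_univ _)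
  have hK : K t ⊆ box r := fun y hy k _ => by
    have := hy k (Set.mem_univ _)
    have h2 := ht k
    exact ⟨by linarith [this.1], this.2⟩
  have hclose : ∀ y ∈ K t, |G n r S y - L| < ε / 2 := by
    intro y hy
    refine hG ?_ (box_sub r (hK hy))
    refine lt_of_le_of_lt ((dist_pi_le_iff dist_nonneg).2 fun k => ?_) htδ
    refine le_trans ?_ (dist_le_pi_dist t 0 k)
    have := hy k (Set.mem_univ _)
    have h2 := ht k
    simp only [Real.dist_eq, Pi.one_apply, Pi.zero_apply, sub_zero]
    rw [abs_of_nonpos (by linarith [this.2]), abs_of_pos h2.1]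
    linarith [this.1]
  have hgi : IntegrableOn (fun y => V r y * W (1/2) r y) (K t) :=
    (VW_int (1/2) (by norm_num) r).mono_set hK
  have hZ : 0 < ∫ y in K t, V r y * W (1/2) r y :=
    VW_pos (1/2) (by norm_num) r t (fun k => (ht k).1) (K t) (K_meas t) hK
      (Set.pi_mono fun _ _ => Set.Ioo_subset_Ico_self)
  have hFi := F_int' n r S (K t) hS hK
  have hGi : IntegrableOn (fun y => G n r S y * (V r y * W (1/2) r y)) (K t) := by
    have := hFi.integral_prod_right
    simp only [inner_eq] at this
    exact this
  rw [integral_prod_symm _ hFi]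
  simp only [inner_eq]
  set Z := ∫ y in K t, V r y * W (1/2) r y with hZdef
  have hdiff : (∫ y in K t, G n r S y * (V r y * W (1/2) r y)) - L * Z
      = ∫ y in K t, (G n r S y - L) * (V r y * W (1/2) r y) := by
    rw [hZdef, ← integral_const_mul, ← integral_sub hGi (hgi.const_mul L)]
    simp only [sub_mul]
  have hbd : |(∫ y in K t, G n r S y * (V r y * W (1/2) r y)) - L * Z| ≤ ε / 2 * Z := by
    rw [hdiff, hZdef, ← integral_const_mul, ← Real.norm_eq_abs]
    refine norm_integral_le_of_norm_le (hgi.const_mul _) ?_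
    filter_upwards [ae_restrict_mem (K_meas t)] with y hy
    have hnn : 0 ≤ V r y * W (1/2) r y :=
      mul_nonneg (V_nonneg r y) (W_nonneg _ r y (box_sub r (hK hy)))
    rw [norm_mul, Real.norm_of_nonneg hnn, Real.norm_eq_abs]
    exact mul_le_mul_of_nonneg_right (hclose y hy).le hnn
  rw [Real.dist_eq, div_sub' hZ.ne', abs_div, abs_of_pos hZ, div_lt_iff₀ hZ, mul_comm Z L]
  refine hbd.trans_lt ?_
  exact mul_lt_mul_of_pos_right (by linarith) hZ

end HardEdge

/-- Conditioning `r` of the `N = n + r` levels of the SO(2N+1) eigenvalue density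
to lie in shrinking neighborhoods `[1 - t_k, 1)` of `1` yields, in the limit
`t → 0+`, the eigenvalue measure of the hardness `m = 2r+1` ensemble:
the weight exponent at the edge `+1` is raised from `1/2` to `2r + 1/2`. -/
theorem so_odd_hard_edge_conditioning (n r : ℕ) (hn : 1 ≤ n) (hr : 1 ≤ r)
    (J : Set (Fin n → ℝ)) (hJ : MeasurableSet J)
    (hJsub : J ⊆ Set.univ.pi fun _ => Set.Ioo (-1 : ℝ) 1) :
    Filter.Tendsto
      (fun t : Fin r → ℝ =>
        (∫ x : Fin (n + r) → ℝ in
            {x | (fun j => x (Fin.castAdd r j)) ∈ J ∧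
                 ∀ k : Fin r, x (Fin.natAdd n k) ∈ Set.Ico (1 - t k) 1},
          (∏ p ∈ Finset.univ.filter
              (fun p : Fin (n + r) × Fin (n + r) => p.1 < p.2),
            (x p.2 - x p.1) ^ 2) *
            ∏ j : Fin (n + r),
              (1 - x j) ^ ((1/2) : ℝ) * (1 + x j) ^ (-(1/2) : ℝ)) /
        (∫ x : Fin (n + r) → ℝ in
            {x | (fun j => x (Fin.castAdd r j)) ∈
                   Set.univ.pi (fun _ : Fin n => Set.Ioo (-1 : ℝ) 1) ∧
                 ∀ k : Fin r, x (Fin.natAdd n k) ∈ Set.Ico (1 - t k) 1},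
          (∏ p ∈ Finset.univ.filter
              (fun p : Fin (n + r) × Fin (n + r) => p.1 < p.2),
            (x p.2 - x p.1) ^ 2) *
            ∏ j : Fin (n + r),
              (1 - x j) ^ ((1/2) : ℝ) * (1 + x j) ^ (-(1/2) : ℝ)))
      (nhdsWithin 0 (Set.univ.pi fun _ : Fin r => Set.Ioo (0 : ℝ) 1))
      (nhds
        ((∫ X : Fin n → ℝ in J,
            (∏ p ∈ Finset.univ.filter
                (fun p : Fin n × Fin n => p.1 < p.2),
              (X p.2 - X p.1) ^ 2) *
              ∏ j : Fin n,
                (1 - X j) ^ ((2 * r : ℝ) + 1/2) * (1 + X j) ^ (-(1/2) : ℝ)) /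
         (∫ X : Fin n → ℝ in Set.univ.pi (fun _ : Fin n => Set.Ioo (-1 : ℝ) 1),
            (∏ p ∈ Finset.univ.filter
                (fun p : Fin n × Fin n => p.1 < p.2),
              (X p.2 - X p.1) ^ 2) *
              ∏ j : Fin n,
                (1 - X j) ^ ((2 * r : ℝ) + 1/2) * (1 + X j) ^ (-(1/2) : ℝ)))) := by
  have hA := HardEdge.avg n r J hJ hJsub
  have hB := HardEdge.avg n r (HardEdge.box n) (HardEdge.box_meas n) subset_rfl
  have hpos : 0 < ∫ x in HardEdge.box n, HardEdge.V n x * HardEdge.W (2 * r + 1/2) n x :=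
    HardEdge.VW_pos _ (by positivity) n (fun _ => 2) (fun _ => by norm_num) _
      (HardEdge.box_meas n) subset_rfl
      (Set.pi_mono fun _ _ => by norm_num)
  refine Tendsto.congr' ?_ (hA.div hB hpos.ne')
  filter_upwards [self_mem_nhdsWithin] with t ht
  have ht : ∀ k, 0 < t k ∧ t k < 1 := fun k => ht k (Set.mem_univ _)
  have hK : HardEdge.K t ⊆ HardEdge.box r := fun y hy k _ => by
    have := hy k (Set.mem_univ _)
    have h2 := ht k
    exact ⟨by linarith [this.1], this.2⟩
  have hZ : 0 < ∫ y in HardEdge.K t, HardEdge.V r y * HardEdge.W (1/2) r y :=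
    HardEdge.VW_pos (1/2) (by norm_num) r t (fun k => (ht k).1) _ (HardEdge.K_meas t) hK
      (Set.pi_mono fun _ _ => Set.Ioo_subset_Ico_self)
  have e1 := HardEdge.num_eq n r J t
  have e2 := HardEdge.num_eq n r (HardEdge.box n) t
  simp only [Pi.div_apply]
  rw [div_div_div_cancel_right₀ hZ.ne', ← e1, ← e2]
  rfl
end

section
/- For every Schwartz function φ : ℝ → ℂ, ∫_ℝ (1 + sin(2πx)/(2πx) − 2·(sin(πx)/(πx))²) · φ(x) dx = φ̂(0) + ∫_{−1}^{1} (2|u| − 3/2) · φ̂(u) du. (Together with the atom 2δ(x), this encodes the distributional identity ρ̂₂(u) = δ(u) + 2 + (2|u| − 3/2)·𝟙_{[−1,1]}(u) for the 'doubly hard' central 1-level density ρ₂(x) = 2δ(x) + 1 + sin(2πx)/(2πx) − 2·(sin(πx)/(πx))².) -/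
open MeasureTheory Real

lemma kernel_integral (x : ℝ) (hx : x ≠ 0) :
    (∫ u in (-1 : ℝ)..1, Complex.exp (((-2 * π * u * x : ℝ) : ℂ) * Complex.I) *
      ((2 * |u| - 3 / 2 : ℝ) : ℂ)) =
    ((Real.sin (2 * Real.pi * x) / (2 * Real.pi * x) -
            2 * (Real.sin (Real.pi * x) / (Real.pi * x)) ^ 2 : ℝ) : ℂ) := by
  have hcont : Continuous fun u : ℝ => Complex.exp (((-2 * π * u * x : ℝ) : ℂ) * Complex.I) *
      ((2 * |u| - 3 / 2 : ℝ) : ℂ) := by fun_prop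
  have hpi : (π : ℂ) ≠ 0 := by exact_mod_cast Real.pi_ne_zero
  have hxc : (x : ℂ) ≠ 0 := by exact_mod_cast hx
  obtain ⟨c, hc⟩ : ∃ c : ℂ, c = -(2 * π * x) * Complex.I := ⟨_, rfl⟩
  have hc0 : c ≠ 0 := by
    rw [hc]; simp [hpi, hxc, Complex.I_ne_zero]
  have hexp : ∀ u : ℝ, Complex.exp (((-2 * π * u * x : ℝ) : ℂ) * Complex.I)
      = Complex.exp (c * u) := by
    intro u; rw [hc]; push_cast; ring_nf
  have hd : ∀ (a b : ℂ) (u : ℝ), HasDerivAt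
      (fun u : ℝ => ((a * u + b) / c - a / c ^ 2) * Complex.exp (c * u))
      (Complex.exp (c * u) * (a * u + b)) u := by
    intro a b u
    have h1 : HasDerivAt (fun z : ℂ => ((a * z + b) / c - a / c ^ 2) * Complex.exp (c * z))
      ((a * 1 / c) * Complex.exp (c * u) +
        ((a * u + b) / c - a / c ^ 2) * (Complex.exp (c * u) * (c * 1))) (u : ℂ) := by
      refine HasDerivAt.mul ?_ ?_
      · exact ((((hasDerivAt_id (u : ℂ)).const_mul a).add_const b).div_const c).sub_const _
      · exact ((hasDerivAt_id (u : ℂ)).const_mul c).cexp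
    convert h1.comp_ofReal using 1
    field_simp
    ring
  have hI : ∀ (a b : ℂ) (s t : ℝ), ∫ u in s..t, Complex.exp (c * u) * (a * u + b) =
      ((a * t + b) / c - a / c ^ 2) * Complex.exp (c * t) -
      ((a * s + b) / c - a / c ^ 2) * Complex.exp (c * s) := by
    intro a b s t
    refine intervalIntegral.integral_eq_sub_of_hasDerivAt (fun u _ => hd a b u) ?_
    exact Continuous.intervalIntegrable (by fun_prop) _ _
  rw [← intervalIntegral.integral_add_adjacent_intervals (b := 0)
    (hcont.intervalIntegrable _ _) (hcont.intervalIntegrable _ _)]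
  have e1 : (∫ u in (-1 : ℝ)..0, Complex.exp (((-2 * π * u * x : ℝ) : ℂ) * Complex.I) *
      ((2 * |u| - 3 / 2 : ℝ) : ℂ)) =
      ∫ u in (-1 : ℝ)..0, Complex.exp (c * u) * ((-2) * u + (-3 / 2)) := by
    refine intervalIntegral.integral_congr fun u hu => ?_
    rw [Set.uIcc_of_le (by norm_num)] at hu
    simp only [hexp, abs_of_nonpos hu.2]
    push_cast; ring
  have e2 : (∫ u in (0 : ℝ)..1, Complex.exp (((-2 * π * u * x : ℝ) : ℂ) * Complex.I) *
      ((2 * |u| - 3 / 2 : ℝ) : ℂ)) =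
      ∫ u in (0 : ℝ)..1, Complex.exp (c * u) * (2 * u + (-3 / 2)) := by
    refine intervalIntegral.integral_congr fun u hu => ?_
    rw [Set.uIcc_of_le (by norm_num)] at hu
    simp only [hexp, abs_of_nonneg hu.1]
    push_cast; ring
  rw [e1, e2, hI, hI]
  have p1 : Complex.exp c = Complex.cos (2 * π * x) - Complex.sin (2 * π * x) * Complex.I := by
    rw [hc, Complex.exp_mul_I, Complex.cos_neg, Complex.sin_neg]; ring
  have p2 : Complex.exp (-c) = Complex.cos (2 * π * x) + Complex.sin (2 * π * x) * Complex.I := by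
    rw [hc, neg_mul, neg_neg, Complex.exp_mul_I]
  have hcos : Complex.cos (2 * π * x) = 1 - 2 * Complex.sin (π * x) ^ 2 := by
    rw [show (2 * π * x : ℂ) = 2 * (π * x) by ring, Complex.cos_two_mul, Complex.cos_sq']; ring
  push_cast
  simp only [mul_zero, mul_one, mul_neg, Complex.exp_zero, p1, p2, hcos, zero_add]
  have hc2 : c ^ 2 = - (2 * π * x) ^ 2 := by rw [hc, mul_pow, Complex.I_sq]; ring
  have hci : c⁻¹ = Complex.I / (2 * π * x) := by
    rw [hc]; field_simp; simp
  simp only [hc2, div_eq_mul_inv _ c, hci]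
  field_simp
  ring_nf
  simp only [Complex.I_sq]
  ring

/-- The nonatomic part of the distributional identity
`ρ̂₂(u) = δ(u) + 2 + (2|u| - 3/2)·𝟙_{[-1,1]}(u)` for the "doubly hard" central
1-level density `ρ₂(x) = 2δ(x) + 1 + sin(2πx)/(2πx) - 2(sin(πx)/(πx))²`,
tested against a Schwartz function `φ` (with `φ̂(u) = ∫ φ(x) e^{-2πixu} dx`). -/
theorem doubly_hard_one_level_density_fourier (φ : SchwartzMap ℝ ℂ) :
    (∫ x : ℝ,
        ((1 + Real.sin (2 * Real.pi * x) / (2 * Real.pi * x) -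
            2 * (Real.sin (Real.pi * x) / (Real.pi * x)) ^ 2 : ℝ) : ℂ) * φ x)
      = FourierTransform.fourier (⇑φ) 0 +
          ∫ u in (-1 : ℝ)..1, ((2 * |u| - 3 / 2 : ℝ) : ℂ) *
            FourierTransform.fourier (⇑φ) u := by
  have hφ : Integrable (⇑φ) := φ.integrable
  obtain ⟨g, hg⟩ : ∃ g : ℝ → ℂ, g = (Set.Ioc (-1 : ℝ) 1).indicator
    (fun u => ((2 * |u| - 3 / 2 : ℝ) : ℂ)) := ⟨_, rfl⟩
  have hgi : Integrable g := by
    rw [hg, integrable_indicator_iff measurableSet_Ioc]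
    exact (Continuous.integrableOn_Icc (by fun_prop)).mono_set Set.Ioc_subset_Icc_self
  have hFg : ∀ x : ℝ, x ≠ 0 → FourierTransform.fourier g x =
    ((Real.sin (2 * Real.pi * x) / (2 * Real.pi * x) -
            2 * (Real.sin (Real.pi * x) / (Real.pi * x)) ^ 2 : ℝ) : ℂ) := by
    intro x hx
    rw [← kernel_integral x hx, Real.fourier_real_eq_integral_exp_smul,
      intervalIntegral.integral_of_le (by norm_num), ← integral_indicator measurableSet_Ioc]
    congr 1
    ext u
    by_cases hu : u ∈ Set.Ioc (-1 : ℝ) 1 <;> simp [hg, hu]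
  have hflip : ∫ x, FourierTransform.fourier g x * φ x =
      ∫ u, g u * FourierTransform.fourier (⇑φ) u := by
    have := VectorFourier.integral_fourierIntegral_smul_eq_flip (μ := volume) (ν := volume)
      (L := innerₗ ℝ) Real.continuous_fourierChar continuous_inner hgi hφ
    rw [flip_innerₗ] at this
    exact this
  have hint : Integrable (fun x => FourierTransform.fourier g x * φ x) := by
    refine hφ.bdd_mul (c := ∫ u, ‖g u‖) ?_ ?_
    · exact (VectorFourier.fourierIntegral_continuous Real.continuous_fourierChar
        (L := innerₗ ℝ) continuous_inner hgi).aestronglyMeasurable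
    · exact Filter.Eventually.of_forall fun x =>
        VectorFourier.norm_fourierIntegral_le_integral_norm _ _ _ _ _
  have h0 : FourierTransform.fourier (⇑φ) 0 = ∫ x, φ x := by
    rw [Real.fourier_real_eq_integral_exp_smul]; simp
  have hR : ∫ u in (-1 : ℝ)..1, ((2 * |u| - 3 / 2 : ℝ) : ℂ) * FourierTransform.fourier (⇑φ) u
      = ∫ u, g u * FourierTransform.fourier (⇑φ) u := by
    rw [intervalIntegral.integral_of_le (by norm_num), ← integral_indicator measurableSet_Ioc]
    congr 1
    ext u
    by_cases hu : u ∈ Set.Ioc (-1 : ℝ) 1 <;> simp [hg, hu]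
  rw [h0, hR, ← hflip, ← integral_add hφ hint]
  refine integral_congr_ae ?_
  filter_upwards [Measure.ae_ne volume (0 : ℝ)] with x hx
  rw [hFg x hx]
  push_cast
  ring
end
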